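/- The set {(u,v) ∈ ℂ² : u² + v² + 1 = 0 and u³ + v³ + 1 = 0} has exactly 6 elements, and at each of its points the gradients (2u, 2v) of u² + v² + 1 and (3u², 3v²) of u³ + v³ + 1 are linearly independent over ℂ (equivalently, the determinant 6uv² − 6u²v is nonzero there). -/

import Mathlib

open Polynomial in
/-- The polynomial obtained by eliminating `v` from `u² + v² + 1` and `u³ + v³ + 1`. -/
noncomputable def conicCubicEliminant : ℂ[X] :=
  2 * X ^ 6 + 3 * X ^ 4 + 2 * X ^ 3 + 3 * X ^ 2 + 2

open Polynomial in
theorem conicCubicEliminant_natDegree : conicCubicEliminant.natDegree = 6 := by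
  unfold conicCubicEliminant
  compute_degree!

open Polynomial in
theorem conicCubicEliminant_separable : conicCubicEliminant.Separable := by
  have hC : (C (1 / 144 : ℂ)) * 144 = 1 := by
    rw [← C_ofNat 144, ← C_mul]
    norm_num
  have hd : derivative conicCubicEliminant = 12 * X ^ 5 + 12 * X ^ 3 + 6 * X ^ 2 + 6 * X := by
    simp only [conicCubicEliminant, derivative_add, derivative_mul, derivative_X_pow,
      derivative_ofNat]
    simp only [Nat.cast_ofNat, C_ofNat]
    ring
  rw [separable_def']
  refine ⟨C (1 / 144) * (72 + 114 * X + 120 * X ^ 2 + 204 * X ^ 3 - 12 * X ^ 4),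
    C (1 / 144) * (-38 - 38 * X - 35 * X ^ 2 - 19 * X ^ 3 - 34 * X ^ 4 + 2 * X ^ 5), ?_⟩
  rw [hd, conicCubicEliminant]
  linear_combination hC

open Polynomial in
theorem conicCubicEliminant_rootSet_ncard : (conicCubicEliminant.rootSet ℂ).ncard = 6 := by
  rw [← Nat.card_coe_set_eq, Nat.card_eq_fintype_card,
    card_rootSet_eq_natDegree conicCubicEliminant_separable (IsAlgClosed.splits _),
    conicCubicEliminant_natDegree]

theorem mem_rootSet_conicCubicEliminant {u : ℂ} :
    u ∈ conicCubicEliminant.rootSet ℂ ↔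
      2 * u ^ 6 + 3 * u ^ 4 + 2 * u ^ 3 + 3 * u ^ 2 + 2 = 0 := by
  rw [Polynomial.mem_rootSet_of_ne conicCubicEliminant_separable.ne_zero]
  simp [conicCubicEliminant]

theorem ne_zero_of_conic_of_cubic {u v : ℂ} (h₂ : u ^ 2 + v ^ 2 + 1 = 0)
    (h₃ : u ^ 3 + v ^ 3 + 1 = 0) : u ≠ 0 := by
  rintro rfl
  have hv : v = 1 := by linear_combination v * h₂ - h₃
  norm_num [hv] at h₂

theorem ne_of_conic_of_cubic {u v : ℂ} (h₂ : u ^ 2 + v ^ 2 + 1 = 0)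
    (h₃ : u ^ 3 + v ^ 3 + 1 = 0) : u ≠ v := by
  rintro rfl
  have hu : u = 1 := by linear_combination u * h₂ - h₃
  norm_num [hu] at h₂

theorem bijOn_fst_conic_cubic :
    Set.BijOn Prod.fst {p : ℂ × ℂ | p.1 ^ 2 + p.2 ^ 2 + 1 = 0 ∧ p.1 ^ 3 + p.2 ^ 3 + 1 = 0}
      (conicCubicEliminant.rootSet ℂ) := by
  refine ⟨?_, ?_, ?_⟩
  · rintro ⟨u, v⟩ ⟨h₂, h₃⟩
    rw [mem_rootSet_conicCubicEliminant]
    linear_combination (u ^ 3 + 1 - v ^ 3) * h₃ +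
      ((u ^ 2 + 1) ^ 2 - (u ^ 2 + 1) * v ^ 2 + v ^ 4) * h₂
  · rintro ⟨u, v⟩ ⟨h₂, h₃⟩ ⟨u', w⟩ ⟨k₂, k₃⟩ (rfl : u = u')
    dsimp only at h₂ h₃ k₂ k₃
    have hv : v ≠ 0 := ne_zero_of_conic_of_cubic (v := u) (by linear_combination h₂)
      (by linear_combination h₃)
    have h : v ^ 2 * (v - w) = 0 := by linear_combination h₃ - k₃ - w * (h₂ - k₂)
    have hvw : v = w := sub_eq_zero.mp ((mul_eq_zero.mp h).resolve_left (pow_ne_zero 2 hv))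
    rw [hvw]
  · intro u hu
    rw [mem_rootSet_conicCubicEliminant] at hu
    have h0 : u ^ 2 + 1 ≠ 0 := by
      intro h
      have hsq : (u ^ 3 + 1) ^ 2 = 0 := by linear_combination hu - (u ^ 2 + 1) ^ 2 * h
      have h3 : u ^ 3 + 1 = 0 := pow_eq_zero_iff two_ne_zero |>.mp hsq
      exact ne_zero_of_conic_of_cubic (u := 0) (v := u) (by linear_combination h)
        (by linear_combination h3) rfl
    refine ⟨(u, (u ^ 3 + 1) / (u ^ 2 + 1)), ⟨?_, ?_⟩, rfl⟩
    · dsimp only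
      field_simp
      linear_combination hu
    · dsimp only
      field_simp
      linear_combination (u ^ 3 + 1) * hu

/-- The set of common zeros of `u² + v² + 1` and `u³ + v³ + 1` in `ℂ²` has exactly 6 elements,
and at each of them the gradients `(2u, 2v)` and `(3u², 3v²)` are linearly independent over `ℂ`
(equivalently, the determinant `6uv² − 6u²v` is nonzero there). -/
theorem common_zeros_conic_cubic
    (S : Set (ℂ × ℂ))
    (hS : S = {p : ℂ × ℂ | p.1 ^ 2 + p.2 ^ 2 + 1 = 0 ∧ p.1 ^ 3 + p.2 ^ 3 + 1 = 0}) :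
    S.ncard = 6 ∧
    ∀ p ∈ S,
      LinearIndependent ℂ ![![2 * p.1, 2 * p.2], ![3 * p.1 ^ 2, 3 * p.2 ^ 2]] ∧
      6 * p.1 * p.2 ^ 2 - 6 * p.1 ^ 2 * p.2 ≠ 0 := by
  subst hS
  refine ⟨bijOn_fst_conic_cubic.ncard_eq.trans conicCubicEliminant_rootSet_ncard, ?_⟩
  rintro ⟨u, v⟩ ⟨h₂, h₃⟩
  dsimp only at h₂ h₃ ⊢
  have hu : u ≠ 0 := ne_zero_of_conic_of_cubic h₂ h₃
  have hv : v ≠ 0 := ne_zero_of_conic_of_cubic (v := u) (by linear_combination h₂)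
    (by linear_combination h₃)
  have hdet : 6 * u * v ^ 2 - 6 * u ^ 2 * v ≠ 0 := by
    have h : 6 * u * v * (v - u) ≠ 0 :=
      mul_ne_zero (mul_ne_zero (mul_ne_zero (by norm_num) hu) hv)
        (sub_ne_zero.mpr (ne_of_conic_of_cubic h₂ h₃).symm)
    intro h'
    exact h (by linear_combination h')
  refine ⟨?_, hdet⟩
  refine Matrix.linearIndependent_rows_of_det_ne_zero
    (A := !![2 * u, 2 * v; 3 * u ^ 2, 3 * v ^ 2]) ?_
  rw [Matrix.det_fin_two_of]
  intro h
  exact hdet (by linear_combination h)
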